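/- Let A ∈ ℂ^{m×n} be a matrix, q ≥ 2 a real number, r_1,…,r_m ∈ ℂ^n the conjugate transposes of the m rows of A, and let w ∈ ℂ^n satisfy ‖w‖_2 = 1. Then for any k with r_k ≠ 0, ‖Aw‖_q ≤ (|⟨w, r_k⟩|/‖r_k‖_2²)·‖Ar_k‖_q + ‖A‖_{2→q} · (1 − |⟨w, r_k⟩|²/‖r_k‖_2²)^{1/2}. -/

import Mathlib

open scoped BigOperators

/-- The `ℓ_p` norm of a vector, for a real exponent `p`. -/
noncomputable def lpnorm {n : ℕ} {𝕜 : Type*} [RCLike 𝕜] (p : ℝ) (x : Fin n → 𝕜) : ℝ :=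
  (∑ i, ‖x i‖ ^ p) ^ (1 / p)

/-- The `ℓ_∞` norm of a vector. -/
noncomputable def linorm {n : ℕ} {𝕜 : Type*} [RCLike 𝕜] (x : Fin n → 𝕜) : ℝ :=
  ⨆ i, ‖x i‖

/-- The `p → q` operator norm of a matrix: `max_{x ≠ 0} ‖Ax‖_q / ‖x‖_p`. -/
noncomputable def opNorm {m n : ℕ} {𝕜 : Type*} [RCLike 𝕜] (p q : ℝ)
    (A : Matrix (Fin m) (Fin n) 𝕜) : ℝ :=
  ⨆ x : {x : Fin n → 𝕜 // x ≠ 0}, lpnorm q (A.mulVec x.1) / lpnorm p x.1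

/-- The `p → ∞` operator norm of a matrix: `max_{x ≠ 0} ‖Ax‖_∞ / ‖x‖_p`. -/
noncomputable def opNormInf {m n : ℕ} {𝕜 : Type*} [RCLike 𝕜] (p : ℝ)
    (A : Matrix (Fin m) (Fin n) 𝕜) : ℝ :=
  ⨆ x : {x : Fin n → 𝕜 // x ≠ 0}, linorm (A.mulVec x.1) / lpnorm p x.1

/-- `row A i` is the conjugate transpose of the `i`-th row of `A`,
so that `(A x) i = ⟨x, row A i⟩` for the standard Hermitian inner product. -/
def row {m n : ℕ} {𝕜 : Type*} [RCLike 𝕜] (A : Matrix (Fin m) (Fin n) 𝕜) (i : Fin m) :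
    Fin n → 𝕜 := fun k => star (A i k)

/-- The standard Hermitian inner product `⟨x, y⟩ = ∑ k, x k * conj (y k)`. -/
noncomputable def hinner {n : ℕ} (x y : Fin n → ℂ) : ℂ := ∑ k, x k * star (y k)

theorem lpnorm_eq_norm_toLp {n : ℕ} {𝕜 : Type*} [RCLike 𝕜] {p : ℝ} (hp : 0 < p)
    (x : Fin n → 𝕜) : lpnorm p x = ‖WithLp.toLp (ENNReal.ofReal p) x‖ := by
  have hp' : (ENNReal.ofReal p).toReal = p := ENNReal.toReal_ofReal hp.le
  rw [PiLp.norm_eq_sum (by rwa [hp']), hp']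
  rfl

theorem lpnorm_two_eq_norm_toLp {n : ℕ} {𝕜 : Type*} [RCLike 𝕜] (x : Fin n → 𝕜) :
    lpnorm 2 x = ‖WithLp.toLp 2 x‖ := by
  simp [lpnorm, PiLp.norm_eq_sum]

theorem hinner_eq_inner_toLp {n : ℕ} (x y : Fin n → ℂ) :
    hinner x y = inner ℂ (WithLp.toLp 2 y) (WithLp.toLp 2 x) := by
  simp [hinner, PiLp.inner_apply]

theorem lpnorm_nonneg {n : ℕ} {𝕜 : Type*} [RCLike 𝕜] (p : ℝ) (x : Fin n → 𝕜) :
    0 ≤ lpnorm p x := by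
  unfold lpnorm
  positivity

theorem lpnorm_add_le {n : ℕ} {𝕜 : Type*} [RCLike 𝕜] {p : ℝ} (hp : 1 ≤ p)
    (x y : Fin n → 𝕜) : lpnorm p (x + y) ≤ lpnorm p x + lpnorm p y := by
  have : Fact (1 ≤ ENNReal.ofReal p) := ⟨ENNReal.one_le_ofReal.2 hp⟩
  simp only [lpnorm_eq_norm_toLp (zero_lt_one.trans_le hp), WithLp.toLp_add]
  exact norm_add_le _ _

theorem lpnorm_smul {n : ℕ} {𝕜 : Type*} [RCLike 𝕜] {p : ℝ} (hp : 1 ≤ p)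
    (c : 𝕜) (x : Fin n → 𝕜) : lpnorm p (c • x) = ‖c‖ * lpnorm p x := by
  have : Fact (1 ≤ ENNReal.ofReal p) := ⟨ENNReal.one_le_ofReal.2 hp⟩
  simp only [lpnorm_eq_norm_toLp (zero_lt_one.trans_le hp), WithLp.toLp_smul]
  exact norm_smul _ _

theorem bddAbove_range_lpnorm_mulVec_div {m n : ℕ} {𝕜 : Type*} [RCLike 𝕜] {p q : ℝ}
    (hp : 1 ≤ p) (hq : 1 ≤ q) (A : Matrix (Fin m) (Fin n) 𝕜) :
    BddAbove (Set.range fun x : {x : Fin n → 𝕜 // x ≠ 0} =>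
      lpnorm q (A.mulVec x.1) / lpnorm p x.1) := by
  have : Fact (1 ≤ ENNReal.ofReal p) := ⟨ENNReal.one_le_ofReal.2 hp⟩
  have : Fact (1 ≤ ENNReal.ofReal q) := ⟨ENNReal.one_le_ofReal.2 hq⟩
  let T := LinearMap.toContinuousLinearMap
    (Matrix.toLpLin (ENNReal.ofReal p) (ENNReal.ofReal q) A)
  refine ⟨‖T‖, ?_⟩
  rintro _ ⟨x, rfl⟩
  refine div_le_of_le_mul₀ (lpnorm_nonneg _ _) (norm_nonneg _) ?_
  rw [lpnorm_eq_norm_toLp (zero_lt_one.trans_le hq),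
    lpnorm_eq_norm_toLp (zero_lt_one.trans_le hp)]
  exact T.le_opNorm (WithLp.toLp _ x.1)

theorem lpnorm_mulVec_le_opNorm_mul {m n : ℕ} {𝕜 : Type*} [RCLike 𝕜] {p q : ℝ}
    (hp : 1 ≤ p) (hq : 1 ≤ q) (A : Matrix (Fin m) (Fin n) 𝕜) (x : Fin n → 𝕜) :
    lpnorm q (A.mulVec x) ≤ opNorm p q A * lpnorm p x := by
  rcases eq_or_ne x 0 with rfl | hx
  · have h0 (r : ℝ) (hr : 1 ≤ r) (l : ℕ) : lpnorm r (0 : Fin l → 𝕜) = 0 := by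
      simpa using lpnorm_smul hr (0 : 𝕜) (0 : Fin l → 𝕜)
    simp [h0 q hq, h0 p hp]
  · have : Fact (1 ≤ ENNReal.ofReal p) := ⟨ENNReal.one_le_ofReal.2 hp⟩
    have hpos : 0 < lpnorm p x := by
      rw [lpnorm_eq_norm_toLp (zero_lt_one.trans_le hp), norm_pos_iff]
      simpa using hx
    rw [← div_le_iff₀ hpos]
    exact le_ciSup (bddAbove_range_lpnorm_mulVec_div hp hq A) ⟨x, hx⟩

/-- Pythagoras for the residual of the orthogonal projection of `w` onto the line of `r`. -/
theorem norm_sub_proj_sq {𝕜 E : Type*} [RCLike 𝕜] [NormedAddCommGroup E]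
    [InnerProductSpace 𝕜 E] (w : E) {r : E} (hr : r ≠ 0) :
    ‖w - (inner 𝕜 r w / (‖r‖ : 𝕜) ^ 2) • r‖ ^ 2 =
      ‖w‖ ^ 2 - ‖inner 𝕜 r w‖ ^ 2 / ‖r‖ ^ 2 := by
  have hr' : ‖r‖ ≠ 0 := norm_ne_zero_iff.2 hr
  have hrc : (‖r‖ : 𝕜) ≠ 0 := RCLike.ofReal_ne_zero.2 hr'
  set c : 𝕜 := inner 𝕜 r w / (‖r‖ : 𝕜) ^ 2 with hc
  have horth : inner 𝕜 (w - c • r) (c • r) = 0 := by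
    rw [inner_smul_right, ← inner_conj_symm, inner_sub_right, inner_smul_right,
      inner_self_eq_norm_sq_to_K, hc, div_mul_cancel₀ _ (pow_ne_zero 2 hrc), sub_self, map_zero,
      mul_zero]
  have h := norm_add_sq_eq_norm_sq_add_norm_sq_of_inner_eq_zero _ _ horth
  have hcr : ‖c • r‖ * ‖c • r‖ = ‖inner 𝕜 r w‖ ^ 2 / ‖r‖ ^ 2 := by
    rw [norm_smul, hc, norm_div, norm_pow, RCLike.norm_ofReal, abs_norm]
    field_simp
  rw [sub_add_cancel, hcr] at h
  linarith

theorem stmt7 {m n : ℕ} (q : ℝ) (hq : 2 ≤ q) (A : Matrix (Fin m) (Fin n) ℂ)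
    (w : Fin n → ℂ) (hw : lpnorm 2 w = 1) (k : Fin m) (hk : row A k ≠ 0) :
    lpnorm q (A.mulVec w) ≤
      ‖hinner w (row A k)‖ / (lpnorm 2 (row A k)) ^ 2 * lpnorm q (A.mulVec (row A k)) +
        opNorm 2 q A *
          Real.sqrt (1 - ‖hinner w (row A k)‖ ^ 2 / (lpnorm 2 (row A k)) ^ 2) := by
  have hq1 : 1 ≤ q := by linarith
  set r := row A k with hr
  set c : ℂ := hinner w r / (lpnorm 2 r : ℂ) ^ 2 with hc
  have hcn : ‖c‖ = ‖hinner w r‖ / lpnorm 2 r ^ 2 := by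
    rw [hc, norm_div, norm_pow, Complex.norm_real, Real.norm_of_nonneg (lpnorm_nonneg _ _)]
  have hres : lpnorm 2 (w - c • r) = √(1 - ‖hinner w r‖ ^ 2 / lpnorm 2 r ^ 2) := by
    have h := norm_sub_proj_sq (𝕜 := ℂ) (WithLp.toLp 2 w) (r := WithLp.toLp 2 r)
      (by simpa using hk)
    rw [← hinner_eq_inner_toLp, ← lpnorm_two_eq_norm_toLp w, hw,
      ← lpnorm_two_eq_norm_toLp r, one_pow] at h
    rw [← h, Real.sqrt_sq (norm_nonneg _), lpnorm_two_eq_norm_toLp, hc,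
      lpnorm_two_eq_norm_toLp r]
    rfl
  calc lpnorm q (A.mulVec w)
      = lpnorm q (c • A.mulVec r + A.mulVec (w - c • r)) := by
        rw [Matrix.mulVec_sub, Matrix.mulVec_smul, add_sub_cancel]
    _ ≤ lpnorm q (c • A.mulVec r) + lpnorm q (A.mulVec (w - c • r)) := lpnorm_add_le hq1 _ _
    _ ≤ _ := by
        rw [lpnorm_smul hq1, hcn, ← hres]
        gcongr
        exact lpnorm_mulVec_le_opNorm_mul one_le_two hq1 A _
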